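/- Suppose n ≥ 3, α ∈ (0,n), λ ≥ n/(n−2), σ ≥ 0, and σ > 1 − ((α−2)/n)·λ. Let φ : (0,1) → (0,∞) be a continuous function with φ(t) → ∞ as t → 0⁺. Then there exists a nonnegative solution u of the Choquard–Pekar inequality problem such that u(x) ≠ O(φ(|x|)) as x → 0. -/

import Mathlib

open MeasureTheory Metric Filter Set Asymptotics Topology

/-- `ℝⁿ` as a Euclidean space. -/
abbrev Euc (n : ℕ) : Type := EuclideanSpace ℝ (Fin n)

/-- The Laplacian `Δu(x) = ∑ i ∂²u/∂xᵢ²(x)`. -/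
noncomputable def lap {n : ℕ} (u : Euc n → ℝ) (x : Euc n) : ℝ :=
  ∑ i : Fin n, iteratedFDeriv ℝ 2 u x ![EuclideanSpace.single i 1, EuclideanSpace.single i 1]

/-- `u` is a nonnegative solution of the Choquard–Pekar inequality problem:
`u ∈ C²(ℝⁿ \ {0}) ∩ L^λ(ℝⁿ)` and
`0 ≤ -Δu(x) ≤ (∫ |x-y|^(-α) u(y)^λ dy) · u(x)^σ` on `B₂(0) \ {0}`. -/
def IsCPSolution (n : ℕ) (α lam sig : ℝ) (u : Euc n → ℝ) : Prop :=
  (∀ x, 0 ≤ u x) ∧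
  ContDiffOn ℝ 2 u {0}ᶜ ∧
  Integrable (fun y => u y ^ lam) ∧
  ∀ x ∈ ball (0 : Euc n) 2 \ {0},
    0 ≤ -lap u x ∧
    -lap u x ≤ (∫ y, ‖x - y‖ ^ (-α) * u y ^ lam) * u x ^ sig

/-- `u(x) ≠ O(φ(|x|))` as `x → 0`: there is a sequence `x_j → 0` with
`u(x_j)/φ(|x_j|) → ∞`. -/
def NotBigOAt (n : ℕ) (u : Euc n → ℝ) (φ : ℝ → ℝ) : Prop :=
  ∃ x : ℕ → Euc n, (∀ j, x j ≠ 0) ∧ Tendsto x atTop (𝓝 0) ∧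
    Tendsto (fun j => u (x j) / φ ‖x j‖) atTop atTop

/-- If `F` has derivative `F'` on `(0, ∞)` and `F' 1 = 0`, then truncating the argument below at `1`
keeps `F` differentiable. -/
lemma hasDerivAt_comp_max_one {F F' : ℝ → ℝ} (hF : ∀ t, 0 < t → HasDerivAt F (F' t) t)
    (h1 : F' 1 = 0) (t : ℝ) : HasDerivAt (fun s => F (max s 1)) (F' (max t 1)) t := by
  rcases lt_trichotomy t 1 with ht | rfl | ht
  · rw [max_eq_right ht.le, h1]
    refine (hasDerivAt_const t (F 1)).congr_of_eventuallyEq ?_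
    filter_upwards [Iio_mem_nhds ht] with s hs
    rw [max_eq_right (le_of_lt hs)]
  · rw [max_self, h1, ← hasDerivWithinAt_univ, ← Iic_union_Ici (a := (1 : ℝ))]
    refine HasDerivWithinAt.union ?_ ?_
    · refine (hasDerivWithinAt_const (1 : ℝ) (Iic 1) (F 1)).congr ?_ (by simp)
      intro s hs
      rw [max_eq_right hs]
    · have := (hF 1 one_pos).hasDerivWithinAt (s := Ici 1)
      rw [h1] at this
      refine this.congr ?_ (by simp)
      intro s hs
      rw [max_eq_left hs]
  · rw [max_eq_left ht.le]
    refine (hF t (by linarith)).congr_of_eventuallyEq ?_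
    filter_upwards [Ioi_mem_nhds ht] with s hs
    rw [max_eq_left (le_of_lt hs)]

/-- The `C²` function equal to `t ^ (-k)` for `t ≥ 1` and to its second order Taylor polynomial at
`1` for `t ≤ 1`. -/
noncomputable def profile (k t : ℝ) : ℝ :=
  (1 - k * (t - 1) + k * (k + 1) / 2 * (t - 1) ^ 2) +
    ((max t 1) ^ (-k) - (1 - k * (max t 1 - 1) + k * (k + 1) / 2 * (max t 1 - 1) ^ 2))

/-- The derivative of `profile`. -/
noncomputable def profileD (k t : ℝ) : ℝ :=
  (-k + k * (k + 1) * (t - 1)) +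
    (-k * (max t 1) ^ (-k - 1) - (-k + k * (k + 1) * (max t 1 - 1)))

/-- The second derivative of `profile`. -/
noncomputable def profileDD (k t : ℝ) : ℝ := k * (k + 1) * (max t 1) ^ (-k - 1 - 1)

lemma hasDerivAt_taylor_quadratic (k t : ℝ) :
    HasDerivAt (fun t : ℝ => 1 - k * (t - 1) + k * (k + 1) / 2 * (t - 1) ^ 2)
      (-k + k * (k + 1) * (t - 1)) t := by
  have h := (hasDerivAt_id t).sub_const 1
  have h2 := ((h.const_mul k).const_sub 1).add ((h.pow 2).const_mul (k * (k + 1) / 2))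
  refine h2.congr_deriv ?_
  simp
  ring

lemma hasDerivAt_taylor_linear (k t : ℝ) :
    HasDerivAt (fun t : ℝ => -k + k * (k + 1) * (t - 1)) (k * (k + 1)) t := by
  have h := (((hasDerivAt_id t).sub_const 1).const_mul (k * (k + 1))).const_add (-k)
  exact h.congr_deriv (by simp)

lemma hasDerivAt_profile (k t : ℝ) : HasDerivAt (profile k) (profileD k t) t := by
  refine (hasDerivAt_taylor_quadratic k t).add
    (hasDerivAt_comp_max_one
      (F := fun t => t ^ (-k) - (1 - k * (t - 1) + k * (k + 1) / 2 * (t - 1) ^ 2))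
      (F' := fun t => -k * t ^ (-k - 1) - (-k + k * (k + 1) * (t - 1))) ?_ (by simp) t)
  intro s hs
  exact (Real.hasDerivAt_rpow_const (Or.inl hs.ne')).sub (hasDerivAt_taylor_quadratic k s)

lemma hasDerivAt_profileD (k t : ℝ) : HasDerivAt (profileD k) (profileDD k t) t := by
  have h := (hasDerivAt_taylor_linear k t).add
    (hasDerivAt_comp_max_one
      (F := fun t => -k * t ^ (-k - 1) - (-k + k * (k + 1) * (t - 1)))
      (F' := fun t => k * (k + 1) * t ^ (-k - 1 - 1) - k * (k + 1)) ?_ (by simp) t)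
  · refine h.congr_deriv ?_
    simp only [profileDD]
    ring
  · intro s hs
    have := ((Real.hasDerivAt_rpow_const (p := -k - 1) (Or.inl hs.ne')).const_mul (-k)).sub
      (hasDerivAt_taylor_linear k s)
    exact this.congr_deriv (by ring)

lemma continuous_profileDD (k : ℝ) : Continuous (profileDD k) := by
  refine continuous_const.mul (Continuous.rpow_const (by fun_prop) fun x => Or.inl ?_)
  have := le_max_right x 1
  positivity

lemma contDiff_profile (k : ℝ) : ContDiff ℝ 2 (profile k) := by
  have h1 : deriv (profile k) = profileD k := funext fun t => (hasDerivAt_profile k t).deriv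
  have h2 : deriv (profileD k) = profileDD k := funext fun t => (hasDerivAt_profileD k t).deriv
  rw [show (2 : WithTop ℕ∞) = 1 + 1 by norm_num, contDiff_succ_iff_deriv, h1,
    contDiff_one_iff_deriv, h2]
  exact ⟨fun t => (hasDerivAt_profile k t).differentiableAt, by simp,
    fun t => (hasDerivAt_profileD k t).differentiableAt, continuous_profileDD k⟩

lemma profile_of_one_le (k : ℝ) {t : ℝ} (ht : 1 ≤ t) : profile k t = t ^ (-k) := by
  simp [profile, max_eq_left ht]

lemma profile_of_le_one (k : ℝ) {t : ℝ} (ht : t ≤ 1) :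
    profile k t = 1 - k * (t - 1) + k * (k + 1) / 2 * (t - 1) ^ 2 := by
  simp [profile, max_eq_right ht]

lemma one_le_profile {k t : ℝ} (hk : 0 ≤ k) (ht : t ≤ 1) : 1 ≤ profile k t := by
  rw [profile_of_le_one k ht]
  nlinarith [mul_nonneg hk (sub_nonneg.2 ht), mul_nonneg (mul_nonneg hk (by linarith : 0 ≤ k + 1))
    (sq_nonneg (t - 1))]

lemma profile_nonneg {k : ℝ} (hk : 0 ≤ k) (t : ℝ) : 0 ≤ profile k t := by
  rcases le_total t 1 with ht | ht
  · linarith [one_le_profile hk ht]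
  · rw [profile_of_one_le k ht]
    positivity

lemma profile_le_rpow {k b t : ℝ} (hk : 0 ≤ k) (hb : 0 ≤ b) (hbk : b ≤ k) (ht : 0 < t) :
    profile k t ≤ (1 + k + k * (k + 1)) * t ^ (-b) := by
  have hkk : 0 ≤ k * (k + 1) := by positivity
  rcases le_total t 1 with h1 | h1
  · have h2 : 1 ≤ t ^ (-b) := Real.one_le_rpow_of_pos_of_le_one_of_nonpos ht h1 (by linarith)
    rw [profile_of_le_one k h1]
    have h3 : 1 - k * (t - 1) + k * (k + 1) / 2 * (t - 1) ^ 2 ≤ 1 + k + k * (k + 1) := by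
      have : (t - 1) ^ 2 ≤ 1 := by nlinarith
      nlinarith [mul_nonneg hk ht.le]
    nlinarith
  · rw [profile_of_one_le k h1]
    have h2 : t ^ (-k) ≤ t ^ (-b) := Real.rpow_le_rpow_of_exponent_le h1 (by linarith)
    have h3 : 0 ≤ t ^ (-b) := by positivity
    nlinarith

lemma profile_radial_laplacian (k t : ℝ) :
    4 * t * profileDD k t + 2 * (2 * k + 2) * profileD k t =
      -(4 * k * (k + 1) * (k + 2) * max (1 - t) 0) := by
  rcases le_total t 1 with h1 | h1
  · rw [profileDD, profileD, max_eq_right h1, max_eq_left (by linarith)]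
    simp
    ring
  · have h0 : 0 < t := by linarith
    rw [profileDD, profileD, max_eq_left h1, max_eq_right (by linarith),
      Real.rpow_sub_one h0.ne' (-k - 1)]
    field_simp
    ring

lemma lap_comp_norm_sq {n : ℕ} {G G' G'' : ℝ → ℝ} (hG : ∀ t, HasDerivAt G (G' t) t)
    (hG' : ∀ t, HasDerivAt G' (G'' t) t) (x : Euc n) :
    lap (fun y : Euc n => G (‖y‖ ^ 2)) x =
      4 * ‖x‖ ^ 2 * G'' (‖x‖ ^ 2) + 2 * n * G' (‖x‖ ^ 2) := by
  have hsq (y : Euc n) : HasFDerivAt (fun y : Euc n => ‖y‖ ^ 2) ((2 : ℝ) • innerSL ℝ y) y := by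
    have := (hasStrictFDerivAt_norm_sq y).hasFDerivAt
    simpa [ofNat_smul_eq_nsmul] using this
  have h1 : fderiv ℝ (fun y : Euc n => G (‖y‖ ^ 2)) =
      fun y => G' (‖y‖ ^ 2) • ((2 : ℝ) • innerSL ℝ y) := by
    funext y
    exact ((hG _).comp_hasFDerivAt y (hsq y)).fderiv
  have h2 : HasFDerivAt (fun y : Euc n => G' (‖y‖ ^ 2) • ((2 : ℝ) • innerSL ℝ y)) _ x :=
    ((hG' _).comp_hasFDerivAt x (hsq x)).smul
      (((innerSL ℝ : Euc n →L[ℝ] Euc n →L[ℝ] ℝ).hasFDerivAt (x := x)).const_smul (2 : ℝ))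
  have hterm (i : Fin n) : iteratedFDeriv ℝ 2 (fun y : Euc n => G (‖y‖ ^ 2)) x
      ![EuclideanSpace.single i 1, EuclideanSpace.single i 1] =
      4 * G'' (‖x‖ ^ 2) * x i ^ 2 + 2 * G' (‖x‖ ^ 2) := by
    rw [iteratedFDeriv_two_apply, h1, h2.fderiv]
    have h3 (v : Euc n) : innerSL ℝ v (EuclideanSpace.single i (1 : ℝ)) = v i := by
      rw [innerSL_apply_apply, EuclideanSpace.inner_single_right]
      simp
    simp only [add_apply, smul_apply,
      ContinuousLinearMap.smulRight_apply, Matrix.cons_val_zero, Matrix.cons_val_one, h3,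
      Function.comp_apply, smul_eq_mul, PiLp.single_apply, if_true]
    ring
  simp only [lap, hterm]
  rw [Finset.sum_add_distrib, ← Finset.mul_sum, ← EuclideanSpace.real_norm_sq_eq]
  simp
  ring

/-- A smooth cutoff on `ℝⁿ`, equal to `1` on the ball of radius `10` and supported in the ball of
radius `20`. -/
noncomputable def cutoff (n : ℕ) : ContDiffBump (0 : Euc n) := ⟨10, 20, by norm_num, by norm_num⟩

/-- The bubble of radius `ρ`: up to the cutoff, it equals `‖z‖ ^ (-2 * k)` for `ρ ≤ ‖z‖`. -/
noncomputable def bubble (n : ℕ) (k ρ : ℝ) (z : Euc n) : ℝ :=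
  cutoff n z * (ρ ^ (-(2 * k)) * profile k (‖z‖ ^ 2 / ρ ^ 2))

lemma cutoff_eq_one {n : ℕ} {z : Euc n} (hz : ‖z‖ ≤ 10) : cutoff n z = 1 :=
  (cutoff n).one_of_mem_closedBall (by simpa [cutoff] using hz)

lemma contDiff_bubble (n : ℕ) (k ρ : ℝ) : ContDiff ℝ 2 (bubble n k ρ) := by
  refine (cutoff n).contDiff.mul (contDiff_const.mul ((contDiff_profile k).comp ?_))
  exact (contDiff_norm_sq ℝ).div_const _

lemma hasCompactSupport_bubble (n : ℕ) (k ρ : ℝ) : HasCompactSupport (bubble n k ρ) :=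
  (cutoff n).hasCompactSupport.mul_right

lemma exists_bound_iteratedFDeriv_bubble (n : ℕ) (k ρ : ℝ) (m : ℕ) :
    ∃ B : ℝ, (m : ℕ∞) ≤ 2 → ∀ z, ‖iteratedFDeriv ℝ m (bubble n k ρ) z‖ ≤ B := by
  by_cases hm : (m : ℕ∞) ≤ 2
  · obtain ⟨B, hB⟩ := ((contDiff_bubble n k ρ).continuous_iteratedFDeriv
      (m := m) (mod_cast hm)).bounded_above_of_compact_support
      ((hasCompactSupport_bubble n k ρ).iteratedFDeriv (𝕜 := ℝ) m)
    exact ⟨B, fun _ => hB⟩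
  · exact ⟨0, fun h => absurd h hm⟩

lemma bubble_nonneg (n : ℕ) {k ρ : ℝ} (hk : 0 ≤ k) (hρ : 0 < ρ) (z : Euc n) :
    0 ≤ bubble n k ρ z :=
  mul_nonneg (cutoff n).nonneg (mul_nonneg (by positivity) (profile_nonneg hk _))

lemma bubble_of_le_norm (n : ℕ) (k : ℝ) {ρ : ℝ} (hρ : 0 < ρ) {z : Euc n} (hz : ρ ≤ ‖z‖) :
    bubble n k ρ z = cutoff n z * ‖z‖ ^ (-(2 * k)) := by
  have h1 : 1 ≤ ‖z‖ ^ 2 / ρ ^ 2 := by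
    rw [one_le_div (by positivity)]
    gcongr
  have h2 : ‖z‖ ^ 2 / ρ ^ 2 = (‖z‖ / ρ) ^ (2 : ℝ) := by
    rw [Real.rpow_two, div_pow]
  rw [bubble, profile_of_one_le k h1, h2, ← Real.rpow_mul (by positivity),
    mul_neg, ← Real.mul_rpow hρ.le (by positivity), mul_div_cancel₀ _ hρ.ne']

lemma le_bubble (n : ℕ) {k ρ : ℝ} (hk : 0 ≤ k) (hρ : 0 < ρ) (hρ' : ρ ≤ 10) {z : Euc n}
    (hz : ‖z‖ ≤ ρ) : ρ ^ (-(2 * k)) ≤ bubble n k ρ z := by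
  rw [bubble, cutoff_eq_one (hz.trans hρ'), one_mul]
  refine le_mul_of_one_le_right (by positivity) (one_le_profile hk ?_)
  rw [div_le_one (by positivity)]
  gcongr

lemma bubble_le (n : ℕ) {k ρ b : ℝ} (hk : 0 ≤ k) (hρ : 0 < ρ) (hb : 0 ≤ b) (hbk : b ≤ 2 * k)
    {z : Euc n} (hz : z ≠ 0) :
    bubble n k ρ z ≤ (1 + k + k * (k + 1)) * ρ ^ (b - 2 * k) *
      (ball (0 : Euc n) 20).indicator (fun z => ‖z‖ ^ (-b)) z := by
  by_cases hz20 : z ∈ ball (0 : Euc n) 20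
  · rw [indicator_of_mem hz20]
    have hz0 : 0 < ‖z‖ := norm_pos_iff.2 hz
    have h2 : (‖z‖ ^ 2 / ρ ^ 2) ^ (-(b / 2)) = ‖z‖ ^ (-b) * ρ ^ b := by
      rw [← div_pow, ← Real.rpow_natCast, ← Real.rpow_mul (by positivity),
        show ((2 : ℕ) : ℝ) * -(b / 2) = -b by push_cast; ring,
        Real.div_rpow hz0.le hρ.le, Real.rpow_neg hρ.le, div_inv_eq_mul]
    calc bubble n k ρ z ≤ 1 * (ρ ^ (-(2 * k)) * profile k (‖z‖ ^ 2 / ρ ^ 2)) := by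
          refine mul_le_mul_of_nonneg_right (cutoff n).le_one ?_
          exact mul_nonneg (by positivity) (profile_nonneg hk _)
      _ ≤ 1 * (ρ ^ (-(2 * k)) * ((1 + k + k * (k + 1)) * (‖z‖ ^ 2 / ρ ^ 2) ^ (-(b / 2)))) := by
          gcongr
          exact profile_le_rpow hk (by positivity) (by linarith) (by positivity)
      _ = _ := by
          rw [h2, sub_eq_add_neg b, Real.rpow_add hρ]
          ring
  · rw [indicator_of_notMem hz20, mul_zero, bubble, (cutoff n).zero_of_le_dist, zero_mul]
    simpa [cutoff] using hz20

/-- The Laplacian is a continuous linear functional of the second iterated derivative. -/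
noncomputable def lapCLM (n : ℕ) :
    ContinuousMultilinearMap ℝ (fun _ : Fin 2 => Euc n) ℝ →L[ℝ] ℝ :=
  ∑ i : Fin n, ContinuousMultilinearMap.apply ℝ (fun _ : Fin 2 => Euc n) ℝ
    ![EuclideanSpace.single i 1, EuclideanSpace.single i 1]

lemma lap_eq_lapCLM {n : ℕ} (u : Euc n → ℝ) (x : Euc n) :
    lap u x = lapCLM n (iteratedFDeriv ℝ 2 u x) := by
  simp [lap, lapCLM]

lemma lap_congr {n : ℕ} {u v : Euc n → ℝ} {x : Euc n} (h : u =ᶠ[𝓝 x] v) : lap u x = lap v x := by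
  rw [lap_eq_lapCLM, lap_eq_lapCLM, (h.iteratedFDeriv ℝ 2).eq_of_nhds]

lemma iteratedFDeriv_mul_comp_sub {n : ℕ} {N : WithTop ℕ∞} {u : Euc n → ℝ} (hu : ContDiff ℝ N u)
    (a : ℝ) (p x : Euc n) {m : ℕ} (hm : (m : WithTop ℕ∞) ≤ N) :
    iteratedFDeriv ℝ m (fun y => a * u (y - p)) x = a • iteratedFDeriv ℝ m u (x - p) := by
  have h : ContDiff ℝ m (fun y => u (y - p)) :=
    (hu.of_le hm).comp (contDiff_id.sub contDiff_const)
  rw [← iteratedFDeriv_comp_sub]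
  exact iteratedFDeriv_const_smul_apply' (a := a) h.contDiffAt

lemma lap_mul_comp_sub {n : ℕ} {u : Euc n → ℝ} (hu : ContDiff ℝ 2 u) (a : ℝ) (p x : Euc n) :
    lap (fun y => a * u (y - p)) x = a * lap u (x - p) := by
  rw [lap_eq_lapCLM, lap_eq_lapCLM, iteratedFDeriv_mul_comp_sub hu a p x (by norm_num), map_smul,
    smul_eq_mul]

lemma lap_bubble {n : ℕ} {k ρ : ℝ} (hnk : (n : ℝ) = 2 * k + 2) (hρ : 0 < ρ) {z : Euc n}
    (hz : ‖z‖ < 10) :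
    lap (bubble n k ρ) z =
      -(4 * k * (k + 1) * (k + 2) * ρ ^ (-(2 * k) - 2) * max (1 - ‖z‖ ^ 2 / ρ ^ 2) 0) := by
  have h1 : bubble n k ρ =ᶠ[𝓝 z]
      fun y => (fun t => ρ ^ (-(2 * k)) * profile k (t / ρ ^ 2)) (‖y‖ ^ 2) := by
    filter_upwards [isOpen_ball.mem_nhds (mem_ball_zero_iff.2 hz)] with y hy
    rw [bubble, cutoff_eq_one (mem_ball_zero_iff.1 hy).le, one_mul]
  have hd (t : ℝ) : HasDerivAt (fun t => t / ρ ^ 2) (1 / ρ ^ 2) t := (hasDerivAt_id t).div_const _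
  rw [lap_congr h1, lap_comp_norm_sq
    (G := fun t => ρ ^ (-(2 * k)) * profile k (t / ρ ^ 2))
    (G' := fun t => ρ ^ (-(2 * k)) * (profileD k (t / ρ ^ 2) * (1 / ρ ^ 2)))
    (G'' := fun t => ρ ^ (-(2 * k)) * (profileDD k (t / ρ ^ 2) * (1 / ρ ^ 2) * (1 / ρ ^ 2)))
    (fun t => ((hasDerivAt_profile k _).comp t (hd t)).const_mul _)
    (fun t => (((hasDerivAt_profileD k _).comp t (hd t)).mul_const _).const_mul _),
    Real.rpow_sub hρ, Real.rpow_two, hnk]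
  have := profile_radial_laplacian k (‖z‖ ^ 2 / ρ ^ 2)
  linear_combination (ρ ^ (-(2 * k)) / ρ ^ 2) * this

lemma bubble_series {n : ℕ} {k : ℝ} {a r : ℕ → ℝ} {p : ℕ → Euc n} (ha : Summable a)
    (ha0 : ∀ j, 0 ≤ a j) (hp : Tendsto p atTop (𝓝 0)) (hr : Tendsto r atTop (𝓝 0))
    (hr0 : ∀ j, 0 < r j) {x : Euc n} (hx : x ≠ 0) :
    ContDiffAt ℝ 2 (fun y => ∑' j, a j * bubble n k (r j) (y - p j)) x ∧
    Summable (fun j => a j * bubble n k (r j) (x - p j)) ∧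
    lap (fun y => ∑' j, a j * bubble n k (r j) (y - p j)) x =
      ∑' j, a j * lap (bubble n k (r j)) (x - p j) := by
  set δ := ‖x‖ / 4 with hδ
  have hδ0 : 0 < δ := by have := norm_pos_iff.2 hx; positivity
  obtain ⟨N, hN⟩ : ∃ N, ∀ j ≥ N, ‖p j‖ < δ ∧ r j < δ := by
    have h1 := (tendsto_order.1 hp.norm).2 δ (by simpa using hδ0)
    have h2 := (tendsto_order.1 hr).2 δ hδ0
    exact eventually_atTop.1 (h1.and h2)
  set ρ : ℕ → ℝ := fun j => if j < N then r j else δ with hρ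
  choose B hB using fun (s : ℝ) (m : ℕ) => exists_bound_iteratedFDeriv_bubble n k s m
  set h : ℕ → Euc n → ℝ := fun j y => a j * bubble n k (ρ j) (y - p j) with hh
  have hcd (j : ℕ) : ContDiff ℝ (2 : ℕ∞) (h j) :=
    contDiff_const.mul ((contDiff_bubble n k (ρ j)).comp (contDiff_id.sub contDiff_const))
  have hbd (m : ℕ) (j : ℕ) (y : Euc n) (hm : (m : ℕ∞) ≤ 2) :
      ‖iteratedFDeriv ℝ m (h j) y‖ ≤ a j * B (ρ j) m := by
    rw [hh, iteratedFDeriv_mul_comp_sub (contDiff_bubble n k (ρ j)) _ _ _ (mod_cast hm), norm_smul,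
      Real.norm_of_nonneg (ha0 j)]
    exact mul_le_mul_of_nonneg_left (hB _ _ hm _) (ha0 j)
  have hv (m : ℕ) (_ : (m : ℕ∞) ≤ 2) : Summable fun j => a j * B (ρ j) m := by
    rw [← summable_nat_add_iff N]
    have : (fun j => a (j + N) * B (ρ (j + N)) m) = fun j => a (j + N) * B δ m := by
      funext j
      simp [hρ]
    rw [this]
    exact ((summable_nat_add_iff N).2 ha).mul_right _
  have heq (y : Euc n) (hy : y ∈ ball x δ) (j : ℕ) :
      a j * bubble n k (r j) (y - p j) = h j y := by
    by_cases hj : j < N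
    · simp [hh, hρ, hj]
    · have hj' := hN j (not_lt.1 hj)
      have h3 : δ ≤ ‖y - p j‖ := by
        have h4 : ‖x‖ ≤ ‖y - p j‖ + ‖p j‖ + ‖x - y‖ := by
          calc ‖x‖ = ‖(y - p j) + p j + (x - y)‖ := by congr 1; abel
            _ ≤ _ := norm_add₃_le
        rw [mem_ball, dist_comm, dist_eq_norm] at hy
        linarith
      simp only [hh, hρ, if_neg hj]
      rw [bubble_of_le_norm n k (hr0 j) (hj'.2.le.trans h3), bubble_of_le_norm n k hδ0 h3]
  have hball : ball x δ ∈ 𝓝 x := ball_mem_nhds x hδ0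
  have hev : (fun y => ∑' j, a j * bubble n k (r j) (y - p j)) =ᶠ[𝓝 x] fun y => ∑' j, h j y := by
    filter_upwards [hball] with y hy
    exact tsum_congr (heq y hy)
  refine ⟨?_, ?_, ?_⟩
  · exact ((contDiff_tsum hcd hv hbd).contDiffAt).congr_of_eventuallyEq hev
  · simp_rw [heq x (mem_ball_self hδ0)]
    refine .of_norm_bounded (hv 0 (by simp)) fun j => ?_
    simpa only [norm_iteratedFDeriv_zero] using hbd 0 j x (by simp)
  · rw [lap_congr hev, lap_eq_lapCLM, iteratedFDeriv_tsum_apply hcd hv hbd (k := 2) (by norm_num),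
      ContinuousLinearMap.map_tsum _ (.of_norm_bounded (hv 2 (by norm_num))
        fun j => hbd 2 j x (by norm_num))]
    refine tsum_congr fun j => ?_
    rw [← lap_eq_lapCLM, ← lap_mul_comp_sub (contDiff_bubble n k (r j))]
    refine lap_congr ?_
    filter_upwards [hball] with y hy
    exact (heq y hy j).symm

lemma integrable_rpow_tsum {X : Type*} [MeasurableSpace X] {μ : Measure X} {lam : ℝ}
    (hlam : 0 < lam) {U V : ℕ → X → ℝ} (hU : ∀ j x, 0 ≤ U j x) (hV : ∀ j x, 0 ≤ V j x)
    (hUV : ∀ j, ∀ᵐ x ∂μ, U j x ≤ (1 / 2) ^ (j + 1) * V j x)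
    (hVm : ∀ j, AEMeasurable (V j) μ)
    (hVi : ∑' j, ∫⁻ x, ENNReal.ofReal (V j x ^ lam) ∂μ ≠ ⊤)
    (hm : AEStronglyMeasurable (fun x => (∑' j, U j x) ^ lam) μ) :
    Integrable (fun x => (∑' j, U j x) ^ lam) μ := by
  have hVm' (j : ℕ) : AEMeasurable (fun x => ENNReal.ofReal (V j x ^ lam)) μ :=
    ((hVm j).pow_const lam).ennreal_ofReal
  rw [← lintegral_tsum hVm'] at hVi
  have hS : AEMeasurable (fun x => ∑' j, ENNReal.ofReal (V j x ^ lam)) μ :=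
    AEMeasurable.tsum hVm'
  refine (integrable_toReal_of_lintegral_ne_top hS hVi).mono' hm ?_
  filter_upwards [ae_lt_top' hS hVi, ae_all_iff.2 hUV] with x hx hUx
  set S := (∑' j, ENNReal.ofReal (V j x ^ lam)).toReal
  have hle (j : ℕ) : V j x ≤ S ^ (lam⁻¹) := by
    have h1 : V j x ^ lam ≤ S :=
      (ENNReal.ofReal_le_iff_le_toReal hx.ne).1 (ENNReal.le_tsum j)
    calc V j x = (V j x ^ lam) ^ lam⁻¹ := (Real.rpow_rpow_inv (hV j x) hlam.ne').symm
      _ ≤ _ := by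
        gcongr
        exact Real.rpow_nonneg (hV j x) _
  have hle' (j : ℕ) : U j x ≤ 1 / 2 / 2 ^ j * S ^ (lam⁻¹) := by
    refine (hUx j).trans ?_
    rw [show (1 / 2 : ℝ) ^ (j + 1) = 1 / 2 / 2 ^ j by rw [pow_succ, one_div_pow]; ring]
    gcongr
    exact hle j
  have hgeo : HasSum (fun j : ℕ => 1 / 2 / 2 ^ j * S ^ (lam⁻¹)) (1 * S ^ (lam⁻¹)) :=
    (hasSum_geometric_two' 1).mul_right _
  have hsum : ∑' j, U j x ≤ S ^ (lam⁻¹) := by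
    rw [← one_mul (S ^ (lam⁻¹)), ← hgeo.tsum_eq]
    exact Summable.tsum_le_tsum hle' (.of_nonneg_of_le (fun j => hU j x) hle' hgeo.summable)
      hgeo.summable
  have h0 : 0 ≤ ∑' j, U j x := tsum_nonneg fun j => hU j x
  rw [Real.norm_of_nonneg (by positivity)]
  calc (∑' j, U j x) ^ lam ≤ (S ^ (lam⁻¹)) ^ lam := by gcongr
    _ = S := Real.rpow_inv_rpow ENNReal.toReal_nonneg hlam.ne'

lemma integrable_indicator_ball_norm_rpow {n : ℕ} (hn : 1 ≤ n) {a : ℝ} (ha : a < n) (R : ℝ) :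
    Integrable ((ball (0 : Euc n) R).indicator fun z => ‖z‖ ^ (-a)) := by
  rw [integrable_indicator_iff measurableSet_ball]
  refine integrableOn_ball_of_norm_le_rpow (C := 1) (α := a) (by simpa) (by simpa) ?_ ?_
  · filter_upwards with x
    rw [Real.norm_of_nonneg (by positivity), one_mul]
  · exact (measurable_norm.pow_const _).aestronglyMeasurable

lemma integrable_riesz_mul {n : ℕ} (hn : 1 ≤ n) {α lam : ℝ} (hα0 : 0 < α) (hαn : α < n)
    (hlam : 0 ≤ lam) {u : Euc n → ℝ} (hu : ∀ x, 0 ≤ u x)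
    (hi : Integrable fun y => u y ^ lam) {x : Euc n} (hx : ContinuousAt u x) :
    Integrable fun y => ‖x - y‖ ^ (-α) * u y ^ lam := by
  obtain ⟨ε, hε, hball⟩ := Metric.eventually_nhds_iff_ball.1
    (hx.eventually_lt_const (lt_add_one (u x)))
  have h1 : Integrable fun y =>
      (u x + 1) ^ lam * (ball (0 : Euc n) ε).indicator (fun z => ‖z‖ ^ (-α)) (x - y) :=
    ((integrable_indicator_ball_norm_rpow hn hαn ε).comp_sub_left x).const_mul _
  refine (h1.add (hi.const_mul (ε ^ (-α)))).mono' ?_ ?_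
  · refine AEStronglyMeasurable.mul ?_ hi.aestronglyMeasurable
    exact ((measurable_const.sub measurable_id).norm.pow_const _).aestronglyMeasurable
  · filter_upwards with y
    have huy := hu y
    have hux := hu x
    rw [Real.norm_of_nonneg (by positivity), Pi.add_apply]
    by_cases hy : x - y ∈ ball (0 : Euc n) ε
    · have h2 : u y < u x + 1 := hball y (by
        rwa [mem_ball, dist_comm, dist_eq_norm, ← mem_ball_zero_iff])
      rw [indicator_of_mem hy]
      have h3 : u y ^ lam ≤ (u x + 1) ^ lam := by gcongr
      have h4 : 0 ≤ ε ^ (-α) * u y ^ lam := by positivity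
      have h5 : 0 ≤ ‖x - y‖ ^ (-α) := by positivity
      nlinarith
    · rw [indicator_of_notMem hy, mul_zero, zero_add]
      have h2 : ε ≤ ‖x - y‖ := by simpa using hy
      have h3 : ‖x - y‖ ^ (-α) ≤ ε ^ (-α) :=
        Real.rpow_le_rpow_of_nonpos hε h2 (by linarith)
      gcongr

lemma riesz_lower_bound {n : ℕ} (hn : 1 ≤ n) {α lam A r : ℝ} (hα0 : 0 < α) (hlam : 0 ≤ lam)
    (hA : 0 ≤ A) (hr : 0 < r) {u : Euc n → ℝ} (hu : ∀ x, 0 ≤ u x) {x p : Euc n}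
    (hx : x ∈ ball p r) (hAu : ∀ y ∈ ball p r, A ≤ u y)
    (hi : Integrable fun y => ‖x - y‖ ^ (-α) * u y ^ lam) :
    (2 * r) ^ (-α) * A ^ lam * (r ^ n * volume.real (ball (0 : Euc n) 1)) ≤
      ∫ y, ‖x - y‖ ^ (-α) * u y ^ lam := by
  have : Nonempty (Fin n) := ⟨⟨0, hn⟩⟩
  have hvol : volume.real (ball p r) = r ^ n * volume.real (ball (0 : Euc n) 1) := by
    rw [measureReal_def, Measure.addHaar_ball _ _ hr.le, ENNReal.toReal_mul,
      ENNReal.toReal_ofReal (by positivity), measureReal_def]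
    simp
  have h1 : ∫ _ in ball p r, (2 * r) ^ (-α) * A ^ lam ≤
      ∫ y in ball p r, ‖x - y‖ ^ (-α) * u y ^ lam := by
    refine setIntegral_mono_on_ae (integrableOn_const measure_ball_lt_top.ne) hi.integrableOn
      measurableSet_ball ?_
    filter_upwards [compl_mem_ae_iff.2 (measure_singleton x)] with y hyx hy
    have hpos : 0 < ‖x - y‖ := norm_pos_iff.2 (sub_ne_zero.2 fun h => hyx h.symm)
    have hlt : ‖x - y‖ ≤ 2 * r := by
      rw [← dist_eq_norm]
      have := dist_triangle_right x y p
      rw [mem_ball] at hx hy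
      linarith
    have h2 : (2 * r) ^ (-α) ≤ ‖x - y‖ ^ (-α) :=
      Real.rpow_le_rpow_of_nonpos hpos hlt (by linarith)
    have h3 := hAu y hy
    gcongr
  rw [setIntegral_const, hvol, smul_eq_mul, mul_comm] at h1
  refine h1.trans (setIntegral_le_integral hi ?_)
  filter_upwards with y
  have := hu y
  positivity

lemma eventually_rpow_le {p c : ℝ} (hp : 0 < p) (hc : 0 < c) :
    ∀ᶠ r in 𝓝[>] (0 : ℝ), r ^ p ≤ c := by
  have h := (Real.continuousAt_rpow_const 0 p (Or.inr hp.le)).tendsto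
  rw [Real.zero_rpow hp.ne'] at h
  exact (h.mono_left nhdsWithin_le_nhds).eventually_le_const hc

lemma exists_radius {s p₁ p₂ p₃ c₁ c₂ c₃ d M : ℝ} (hs : 0 < s) (hp₁ : 0 < p₁) (hp₂ : 0 < p₂)
    (hp₃ : 0 < p₃) (hc₁ : 0 < c₁) (hc₂ : 0 < c₂) (hc₃ : 0 < c₃) (hd : 0 < d) :
    ∃ r : ℝ, 0 < r ∧ r ≤ d ∧ M ≤ r ^ (-s) ∧ r ^ p₁ ≤ c₁ ∧ r ^ p₂ ≤ c₂ ∧ r ^ p₃ ≤ c₃ := by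
  have h1 : ∀ᶠ r in 𝓝[>] (0 : ℝ), 0 < r := self_mem_nhdsWithin
  have h2 : ∀ᶠ r in 𝓝[>] (0 : ℝ), r ≤ d :=
    nhdsWithin_le_nhds (Iic_mem_nhds hd)
  have h3 := (tendsto_rpow_neg_nhdsGT_zero (neg_lt_zero.2 hs)).eventually_ge_atTop M
  exact (h1.and (h2.and (h3.and ((eventually_rpow_le hp₁ hc₁).and
    ((eventually_rpow_le hp₂ hc₂).and (eventually_rpow_le hp₃ hc₃)))))).exists

lemma isCPSolution_bubble_series {n : ℕ} (hn : 3 ≤ n) {α lam sig k s b : ℝ} (hα0 : 0 < α)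
    (hαn : α < n) (hlam : 1 ≤ lam) (hsig0 : 0 ≤ sig) (hnk : (n : ℝ) = 2 * k + 2)
    (hb0 : 0 ≤ b) (hbk : b ≤ 2 * k) (hbn : b * lam < n) {d r : ℕ → ℝ} {p : ℕ → Euc n}
    (hd : ∀ j, d j = (1 / 2) ^ (j + 1)) (hpd : ∀ j, ‖p j‖ = d j) (hr0 : ∀ j, 0 < r j)
    (hrd : ∀ j, r j ≤ d j / 4)
    (hr₁ : ∀ j, r j ^ (b - s) ≤ (1 / 4) ^ (j + 1))
    (hr₂ : ∀ j, r j ^ (2 * k - s) ≤ (1 / 2) ^ (j + 1))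
    (hr₃ : ∀ j, r j ^ (s * (lam + sig - 1) - (n + 2 - α)) ≤
      2 ^ (-α) * volume.real (ball (0 : Euc n) 1) / (4 * k * (k + 1) * (k + 2))) :
    IsCPSolution n α lam sig
      (fun x => ∑' j, r j ^ (2 * k - s) * bubble n k (r j) (x - p j)) ∧
    ∀ j, r j ^ (-s) ≤ ∑' i, r i ^ (2 * k - s) * bubble n k (r i) (p j - p i) := by
  have hk : 0 < k := by
    have : (3 : ℝ) ≤ n := by exact_mod_cast hn
    linarith
  have : Nonempty (Fin n) := ⟨⟨0, by lia⟩⟩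
  set a : ℕ → ℝ := fun j => r j ^ (2 * k - s) with ha
  have ha0 (j : ℕ) : 0 ≤ a j := by have := hr0 j; positivity
  have hU0 (j : ℕ) (x : Euc n) : 0 ≤ a j * bubble n k (r j) (x - p j) :=
    mul_nonneg (ha0 j) (bubble_nonneg n hk.le (hr0 j) _)
  set u : Euc n → ℝ := fun x => ∑' j, a j * bubble n k (r j) (x - p j) with hu
  have hu0 (x : Euc n) : 0 ≤ u x := tsum_nonneg fun j => hU0 j x
  have hgeo : Summable fun j : ℕ => (1 / 2 : ℝ) ^ (j + 1) :=
    (summable_nat_add_iff 1).2 summable_geometric_two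
  have hd1 (j : ℕ) : d j ≤ 1 / 2 := by
    rw [hd, pow_succ]
    exact mul_le_of_le_one_left (by norm_num) (pow_le_one₀ (by norm_num) (by norm_num))
  have hdpos (j : ℕ) : 0 < d j := by rw [hd]; positivity
  have hr1 (j : ℕ) : r j ≤ 1 := by linarith [hrd j, hd1 j]
  have hdt : Tendsto d atTop (𝓝 0) := by
    rw [show d = _ from funext hd]
    exact hgeo.tendsto_atTop_zero
  have hpt : Tendsto p atTop (𝓝 0) := by
    rw [tendsto_zero_iff_norm_tendsto_zero, show (fun j => ‖p j‖) = d from funext hpd]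
    exact hdt
  have hrt : Tendsto r atTop (𝓝 0) :=
    squeeze_zero (fun j => (hr0 j).le) (fun j => by linarith [hrd j, hdpos j]) hdt
  have hseries (x : Euc n) (hx : x ≠ 0) :=
    bubble_series (k := k) (.of_nonneg_of_le ha0 hr₂ hgeo) ha0 hpt hrt hr0 hx
  have hball0 (j : ℕ) (y : Euc n) (hy : y ∈ ball (p j) (r j)) :
      3 / 4 * d j < ‖y‖ ∧ ‖y‖ < 5 / 4 * d j := by
    rw [mem_ball, dist_eq_norm] at hy
    have h1 := abs_le.1 (abs_norm_sub_norm_le y (p j))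
    have h2 := hrd j
    have h3 := hpd j
    constructor <;> linarith [h1.1, h1.2]
  have hball (j : ℕ) (y : Euc n) (hy : y ∈ ball (p j) (r j)) : r j ^ (-s) ≤ u y := by
    have hy0 : y ≠ 0 := norm_pos_iff.1 (by linarith [(hball0 j y hy).1, hdpos j])
    calc r j ^ (-s) = a j * r j ^ (-(2 * k)) := by
          rw [ha, ← Real.rpow_add (hr0 j)]
          congr 1
          ring
      _ ≤ a j * bubble n k (r j) (y - p j) := by
          refine mul_le_mul_of_nonneg_left (le_bubble n hk.le (hr0 j) ?_ ?_) (ha0 j)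
          · linarith [hr1 j]
          · rw [mem_ball, dist_eq_norm] at hy
            exact hy.le
      _ ≤ u y := (hseries y hy0).2.1.le_tsum j fun i _ => hU0 i y
  have hcd : ContDiffOn ℝ 2 u {0}ᶜ := fun x hx => (hseries x hx).1.contDiffWithinAt
  have hint : Integrable fun y => u y ^ lam := by
    set C := 1 + k + k * (k + 1)
    have hC : 0 ≤ C := by positivity
    set w : Euc n → ℝ := (ball (0 : Euc n) 20).indicator fun z => ‖z‖ ^ (-b) with hw
    have hw0 (z : Euc n) : 0 ≤ w z := indicator_nonneg (fun z _ => by positivity) z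
    have hwm : Measurable w := (measurable_norm.pow_const _).indicator measurableSet_ball
    have hwl : (fun z => w z ^ lam) =
        (ball (0 : Euc n) 20).indicator fun z => ‖z‖ ^ (-(b * lam)) := by
      funext z
      by_cases hz : z ∈ ball (0 : Euc n) 20
      · rw [hw, indicator_of_mem hz, indicator_of_mem hz, ← Real.rpow_mul (norm_nonneg z), neg_mul]
      · rw [hw, indicator_of_notMem hz, indicator_of_notMem hz, Real.zero_rpow (by linarith)]
    have hwi : Integrable fun z => w z ^ lam := by
      rw [hwl]
      exact integrable_indicator_ball_norm_rpow (by lia) hbn 20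
    refine integrable_rpow_tsum (by linarith) (V := fun j x => C * (1 / 2) ^ (j + 1) * w (x - p j))
      hU0 (fun j x => mul_nonneg (by positivity) (hw0 _)) ?_ ?_ ?_ ?_
    · intro j
      filter_upwards [compl_mem_ae_iff.2 (measure_singleton (p j))] with x hx
      have hxp : x - p j ≠ 0 := sub_ne_zero.2 hx
      have hwx := hw0 (x - p j)
      calc a j * bubble n k (r j) (x - p j)
          ≤ a j * (C * r j ^ (b - 2 * k) * w (x - p j)) :=
            mul_le_mul_of_nonneg_left (bubble_le n hk.le (hr0 j) hb0 hbk hxp) (ha0 j)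
        _ = C * r j ^ (b - s) * w (x - p j) := by
            rw [show b - s = (2 * k - s) + (b - 2 * k) by ring, Real.rpow_add (hr0 j)]
            ring
        _ ≤ C * (1 / 4) ^ (j + 1) * w (x - p j) := by
            have := hr₁ j
            gcongr
        _ = _ := by
            rw [show (1 / 4 : ℝ) = 1 / 2 * (1 / 2) by norm_num, mul_pow]
            ring
    · exact fun j => ((hwm.comp (measurable_id.sub_const _)).const_mul _).aemeasurable
    · have hVj (j : ℕ) :
          ∫⁻ x, ENNReal.ofReal ((C * (1 / 2) ^ (j + 1) * w (x - p j)) ^ lam) ≤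
            ENNReal.ofReal (C ^ lam * (1 / 2) ^ (j + 1)) *
              ∫⁻ x, ENNReal.ofReal (w x ^ lam) := by
        rw [← lintegral_sub_right_eq_self (fun x => ENNReal.ofReal (w x ^ lam)) (p j),
          ← lintegral_const_mul' _ _ ENNReal.ofReal_ne_top]
        refine lintegral_mono fun x => ?_
        rw [← ENNReal.ofReal_mul (by positivity)]
        refine ENNReal.ofReal_le_ofReal ?_
        rw [Real.mul_rpow (by positivity) (hw0 _), Real.mul_rpow hC (by positivity)]
        have hwx := hw0 (x - p j)
        have h1 : ((1 / 2 : ℝ) ^ (j + 1)) ^ lam ≤ (1 / 2) ^ (j + 1) := by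
          conv_rhs => rw [← Real.rpow_one ((1 / 2 : ℝ) ^ (j + 1))]
          exact Real.rpow_le_rpow_of_exponent_ge (by positivity)
            (pow_le_one₀ (by norm_num) (by norm_num)) hlam
        gcongr
      refine ne_top_of_le_ne_top ?_ (ENNReal.tsum_le_tsum hVj)
      rw [ENNReal.tsum_mul_right]
      refine ENNReal.mul_ne_top (hgeo.mul_left _).tsum_ofReal_ne_top ?_
      rw [← ofReal_integral_eq_lintegral_ofReal hwi
        (Eventually.of_forall fun z => Real.rpow_nonneg (hw0 z) _)]
      exact ENNReal.ofReal_ne_top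
    · have hc : ContinuousOn (fun x => u x ^ lam) {0}ᶜ :=
        hcd.continuousOn.rpow_const fun x _ => Or.inr (by linarith)
      have hm := hc.aestronglyMeasurable (μ := volume) (measurableSet_singleton 0).compl
      rwa [restrict_compl_singleton] at hm
  have hlap (j : ℕ) (x : Euc n) (hx : ‖x‖ < 2) : a j * lap (bubble n k (r j)) (x - p j) =
      -(4 * k * (k + 1) * (k + 2) * r j ^ (-s - 2) *
        max (1 - ‖x - p j‖ ^ 2 / r j ^ 2) 0) := by
    rw [lap_bubble hnk (hr0 j), show -s - 2 = (2 * k - s) + (-(2 * k) - 2) by ring,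
      Real.rpow_add (hr0 j)]
    · ring
    · linarith [norm_sub_le x (p j), hpd j, hd1 j]
  refine ⟨⟨hu0, hcd, hint, ?_⟩, fun j => hball j (p j) (mem_ball_self (hr0 j))⟩
  rintro x ⟨hx2, hx0⟩
  rw [mem_ball_zero_iff] at hx2
  obtain ⟨hcx, -, hlx⟩ := hseries x hx0
  rw [hlx, ← tsum_neg]
  simp_rw [hlap _ x hx2, neg_neg]
  refine ⟨tsum_nonneg fun j => ?_, ?_⟩
  · have := hr0 j
    positivity
  have hint0 : 0 ≤ ∫ y, ‖x - y‖ ^ (-α) * u y ^ lam :=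
    integral_nonneg fun y => mul_nonneg (by positivity) (Real.rpow_nonneg (hu0 y) _)
  have hvanish (j : ℕ) (hj : x ∉ ball (p j) (r j)) : max (1 - ‖x - p j‖ ^ 2 / r j ^ 2) 0 = 0 := by
    rw [mem_ball, dist_eq_norm, not_lt] at hj
    refine max_eq_right (sub_nonpos.2 ?_)
    have := hr0 j
    rw [one_le_div (by positivity)]
    gcongr
  by_cases hex : ∃ j, x ∈ ball (p j) (r j)
  · obtain ⟨j, hj⟩ := hex
    have hother (i : ℕ) (hij : i ≠ j) : x ∉ ball (p i) (r i) := by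
      intro hi
      have hd2 {l m : ℕ} (h : l < m) : 2 * d m ≤ d l := by
        rw [hd, hd, pow_succ (1 / 2 : ℝ) m]
        have : (1 / 2 : ℝ) ^ m ≤ (1 / 2) ^ (l + 1) :=
          pow_le_pow_of_le_one (by norm_num) (by norm_num) h
        linarith
      obtain ⟨h1, h2⟩ := hball0 i x hi
      obtain ⟨h3, h4⟩ := hball0 j x hj
      have h5 := hdpos i
      have h6 := hdpos j
      rcases hij.lt_or_gt with h | h
      · linarith [hd2 h]
      · linarith [hd2 h]
    rw [tsum_eq_single j fun i hi => by rw [hvanish i (hother i hi), mul_zero]]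
    have hrj := hr0 j
    set A := r j ^ (-s) with hA
    set ω := volume.real (ball (0 : Euc n) 1)
    set D := 4 * k * (k + 1) * (k + 2) with hD
    have hDpos : 0 < D := by positivity
    have hI := riesz_lower_bound (by lia) hα0 (by linarith) (by positivity : 0 ≤ A) hrj hu0 hj
      (hball j) (integrable_riesz_mul (by lia) hα0 hαn (by linarith) hu0 hint hcx.continuousAt)
    have hu1 : A ^ sig ≤ u x ^ sig := by
      have := hball j x hj
      gcongr
    have hmax : max (1 - ‖x - p j‖ ^ 2 / r j ^ 2) 0 ≤ 1 := by
      refine max_le ?_ zero_le_one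
      have : 0 ≤ ‖x - p j‖ ^ 2 / r j ^ 2 := by positivity
      linarith
    calc D * r j ^ (-s - 2) * max (1 - ‖x - p j‖ ^ 2 / r j ^ 2) 0
        ≤ D * r j ^ (-s - 2) * 1 := by gcongr
      _ = D * r j ^ (s * (lam + sig - 1) - (n + 2 - α)) *
            r j ^ (-α + -s * lam + n + -s * sig) := by
          rw [mul_one, mul_assoc D, ← Real.rpow_add hrj]
          congr 2
          ring
      _ ≤ 2 ^ (-α) * ω * r j ^ (-α + -s * lam + n + -s * sig) := by
          have h := hr₃ j
          rw [le_div_iff₀ hDpos, mul_comm] at h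
          gcongr
      _ = (2 * r j) ^ (-α) * A ^ lam * (r j ^ n * ω) * A ^ sig := by
          rw [hA, Real.mul_rpow zero_le_two hrj.le, ← Real.rpow_mul hrj.le,
            ← Real.rpow_mul hrj.le, Real.rpow_add hrj, Real.rpow_add hrj, Real.rpow_add hrj,
            Real.rpow_natCast]
          ring
      _ ≤ _ := mul_le_mul hI hu1 (by positivity) hint0
  · rw [not_exists] at hex
    simp_rw [fun j => hvanish j (hex j), mul_zero, tsum_zero]
    exact mul_nonneg hint0 (Real.rpow_nonneg (hu0 x) _)

theorem stmt16 (n : ℕ) (hn : 3 ≤ n) (α lam sig : ℝ)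
    (hα0 : 0 < α) (hαn : α < n)
    (hlam : (n : ℝ) / ((n : ℝ) - 2) ≤ lam)
    (hsig0 : 0 ≤ sig) (hsig1 : 1 - (α - 2) / (n : ℝ) * lam < sig)
    (φ : ℝ → ℝ) (hφc : ContinuousOn φ (Ioo 0 1))
    (hφp : ∀ t ∈ Ioo (0:ℝ) 1, 0 < φ t)
    (hφl : Tendsto φ (𝓝[>] (0:ℝ)) atTop) :
    ∃ u : Euc n → ℝ, IsCPSolution n α lam sig u ∧ NotBigOAt n u φ := by
  have hn3 : (3 : ℝ) ≤ n := by exact_mod_cast hn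
  have hn2 : (0 : ℝ) < (n : ℝ) - 2 := by linarith
  have hlam1 : 1 < lam := lt_of_lt_of_le (by rw [one_lt_div hn2]; linarith) hlam
  have hlam0 : 0 < lam := by linarith
  have hgap : 0 < lam + sig - 1 := by linarith
  have hcrit : (n + 2 - α) / (lam + sig - 1) < n / lam := by
    rw [div_lt_div_iff₀ hgap hlam0]
    have h1 : (1 - (α - 2) / (n : ℝ) * lam) * n < sig * n :=
      mul_lt_mul_of_pos_right hsig1 (by linarith)
    have h2 : (1 - (α - 2) / (n : ℝ) * lam) * n = n - (α - 2) * lam := by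
      field_simp
    nlinarith
  obtain ⟨s, hs1, hs2⟩ := exists_between hcrit
  obtain ⟨b, hsb, hbn⟩ := exists_between hs2
  have hs0 : 0 < s := lt_trans (div_pos (by linarith) hgap) hs1
  have hnlam : n / lam ≤ (n : ℝ) - 2 := by
    rw [div_le_iff₀ hn2] at hlam
    rw [div_le_iff₀ hlam0]
    linarith
  have hexp : 0 < s * (lam + sig - 1) - (n + 2 - α) := by
    rw [div_lt_iff₀ hgap] at hs1
    linarith
  rw [lt_div_iff₀ hlam0] at hbn
  set k : ℝ := ((n : ℝ) - 2) / 2 with hk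
  have hk0 : 0 < k := by positivity
  have hbk : b < 2 * k := by
    have : b < n / lam := (lt_div_iff₀ hlam0).2 hbn
    linarith
  have hω : 0 < volume.real (ball (0 : Euc n) 1) :=
    ENNReal.toReal_pos (measure_ball_pos _ _ one_pos).ne' measure_ball_lt_top.ne
  set d : ℕ → ℝ := fun j => (1 / 2) ^ (j + 1) with hd
  have hd0 (j : ℕ) : 0 < d j := by positivity
  have hd1 (j : ℕ) : d j < 1 := pow_lt_one₀ (by norm_num) (by norm_num) (by simp)
  choose r hr0 hrd hrM hr₁ hr₂ hr₃ using fun j : ℕ =>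
    exists_radius (M := j * φ (d j)) (d := d j / 4) (c₁ := (1 / 4) ^ (j + 1))
      (c₂ := (1 / 2) ^ (j + 1))
      (c₃ := 2 ^ (-α) * volume.real (ball (0 : Euc n) 1) / (4 * k * (k + 1) * (k + 2)))
      hs0 (sub_pos.2 hsb) (sub_pos.2 (hsb.trans hbk)) hexp (by positivity) (by positivity)
      (by positivity) (by have := hd0 j; positivity)
  set p : ℕ → Euc n := fun j => EuclideanSpace.single ⟨0, by lia⟩ (d j) with hp
  have hpd (j : ℕ) : ‖p j‖ = d j := by
    rw [hp, PiLp.norm_single, Real.norm_of_nonneg (hd0 j).le]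
  obtain ⟨hsol, hge⟩ := isCPSolution_bubble_series hn hα0 hαn hlam1.le hsig0
    (by rw [hk]; ring) (hs0.trans hsb).le hbk.le hbn (fun _ => rfl) hpd hr0 hrd hr₁ hr₂ hr₃
  refine ⟨_, hsol, p, fun j => norm_pos_iff.1 (by rw [hpd]; exact hd0 j), ?_, ?_⟩
  · rw [tendsto_zero_iff_norm_tendsto_zero]
    simp_rw [hpd]
    exact ((summable_nat_add_iff 1).2 summable_geometric_two).tendsto_atTop_zero
  · refine tendsto_atTop_mono (fun j => ?_) (tendsto_natCast_atTop_atTop (R := ℝ))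
    rw [hpd, le_div_iff₀ (hφp _ ⟨hd0 j, hd1 j⟩)]
    exact (hrM j).trans (hge j)
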